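/- Let G be the 7 × 7 real symmetric matrix with all diagonal entries equal to 1 and off-diagonal entries (symmetrically extended) G₁₂ = −1, G₁₃ = −(√2/2 + √15/3), G₂₄ = −(√2/2 + √15/3), G₁₄ = −√2/2, G₂₃ = −√2/2, G₃₅ = −1/2, G₄₇ = −1/2, G₅₆ = −1/2, G₆₇ = −1/2, G₅₇ = −1/2, and all other off-diagonal entries 0. Then G has exactly 4 positive eigenvalues (with multiplicity), exactly 1 negative eigenvalue, and exactly 2 zero eigenvalues; equivalently G has rank 5 and signature (4,1). -/

import Mathlib

open Real

noncomputable def G4 : Matrix (Fin 7) (Fin 7) ℝ :=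
  !![1, -1, -(Real.sqrt 2 / 2 + Real.sqrt 15 / 3), -(Real.sqrt 2 / 2), 0, 0, 0;
     -1, 1, -(Real.sqrt 2 / 2), -(Real.sqrt 2 / 2 + Real.sqrt 15 / 3), 0, 0, 0;
     -(Real.sqrt 2 / 2 + Real.sqrt 15 / 3), -(Real.sqrt 2 / 2), 1, 0, -(1/2), 0, 0;
     -(Real.sqrt 2 / 2), -(Real.sqrt 2 / 2 + Real.sqrt 15 / 3), 0, 1, 0, 0, -(1/2);
     0, 0, -(1/2), 0, 1, -(1/2), -(1/2);
     0, 0, 0, 0, -(1/2), 1, -(1/2);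
     0, 0, 0, -(1/2), -(1/2), -(1/2), 1]

open Finset in
/-- **Sylvester's law of inertia**, one inequality: if a quadratic form is written as a signed sum
of squares in two ways, the first of them in independent coordinates on all of `V`, then the first
has at most as many positive coefficients as the second. -/
theorem card_pos_le_of_sum_sq_eq {V ι κ : Type*} [AddCommGroup V] [Module ℝ V]
    [FiniteDimensional ℝ V] [Fintype ι] [Fintype κ] (c : V →ₗ[ℝ] ι → ℝ)
    (hc : Function.Injective c) (hι : Fintype.card ι = Module.finrank ℝ V)
    (b : V →ₗ[ℝ] κ → ℝ) (d : ι → ℝ) (e : κ → ℝ)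
    (h : ∀ x, ∑ i, d i * c x i ^ 2 = ∑ j, e j * b x j ^ 2) :
    #{i | 0 < d i} ≤ #{j | 0 < e j} := by
  by_contra! hlt
  let f : V →ₗ[ℝ] ({i // ¬ 0 < d i} → ℝ) × ({j // 0 < e j} → ℝ) :=
    ((LinearMap.funLeft ℝ ℝ Subtype.val).comp c).prod
      ((LinearMap.funLeft ℝ ℝ Subtype.val).comp b)
  have hdim : Module.finrank ℝ (({i // ¬ 0 < d i} → ℝ) × ({j // 0 < e j} → ℝ)) <
      Module.finrank ℝ V := by
    rw [Module.finrank_prod, Module.finrank_fintype_fun_eq_card,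
      Module.finrank_fintype_fun_eq_card, Fintype.card_subtype, Fintype.card_subtype, ← hι]
    have := card_filter_add_card_filter_not (s := (univ : Finset ι)) (fun i => 0 < d i)
    rw [card_univ] at this
    omega
  obtain ⟨x, hx, hx0⟩ := Submodule.exists_mem_ne_zero_of_ne_bot
    (LinearMap.ker_ne_bot_of_finrank_lt (f := f) hdim)
  have hcx : ∀ i, ¬ 0 < d i → c x i = 0 := fun i hi =>
    congrFun (congrArg Prod.fst (LinearMap.mem_ker.1 hx)) ⟨i, hi⟩
  have hbx : ∀ j, 0 < e j → b x j = 0 := fun j hj =>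
    congrFun (congrArg Prod.snd (LinearMap.mem_ker.1 hx)) ⟨j, hj⟩
  have hnonneg : ∀ i ∈ univ, 0 ≤ d i * c x i ^ 2 := by
    intro i _
    by_cases hi : 0 < d i
    · positivity
    · simp [hcx i hi]
  have hnonpos : ∑ j, e j * b x j ^ 2 ≤ 0 := by
    refine sum_nonpos fun j _ => ?_
    by_cases hj : 0 < e j
    · simp [hbx j hj]
    · exact mul_nonpos_of_nonpos_of_nonneg (not_lt.1 hj) (sq_nonneg _)
  have hzero := (sum_eq_zero_iff_of_nonneg hnonneg).1
    (le_antisymm ((h x).trans_le hnonpos) (sum_nonneg hnonneg))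
  refine hx0 (hc ?_)
  rw [map_zero]
  ext i
  by_cases hi : 0 < d i
  · simpa [hi.ne'] using hzero i (mem_univ i)
  · exact hcx i hi

theorem Matrix.IsHermitian.dotProduct_mulVec_eq_sum_eigenvalues {n : Type*} [Fintype n]
    [DecidableEq n] {A : Matrix n n ℝ} (hA : A.IsHermitian) (x : n → ℝ) :
    x ⬝ᵥ A.mulVec x = ∑ i, hA.eigenvalues i *
      (star (hA.eigenvectorUnitary : Matrix n n ℝ)).mulVec x i ^ 2 := by
  conv_lhs => rw [hA.spectral_theorem, Unitary.conjStarAlgAut_apply]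
  rw [← Matrix.mulVec_mulVec, ← Matrix.mulVec_mulVec, Matrix.dotProduct_mulVec,
    ← Matrix.mulVec_transpose]
  simp only [Matrix.star_eq_conjTranspose, Matrix.conjTranspose_eq_transpose_of_trivial,
    Matrix.mulVec_diagonal, dotProduct, Function.comp, RCLike.ofReal_real_eq_id, id]
  exact Finset.sum_congr rfl fun i _ => by ring

open Finset in
/-- **Sylvester's law of inertia** for the eigenvalues of a real symmetric matrix. -/
theorem Matrix.IsHermitian.card_eigenvalues_of_sum_sq {n : Type*} [Fintype n]
    [DecidableEq n] {A : Matrix n n ℝ} (hA : A.IsHermitian) (b : (n → ℝ) →ₗ[ℝ] n → ℝ)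
    (hb : Function.Injective b) (e : n → ℝ)
    (h : ∀ x, x ⬝ᵥ A.mulVec x = ∑ j, e j * b x j ^ 2) :
    #{i | 0 < hA.eigenvalues i} = #{j | 0 < e j} ∧
      #{i | hA.eigenvalues i < 0} = #{j | e j < 0} := by
  let c := (star (hA.eigenvectorUnitary : Matrix n n ℝ)).mulVecLin
  have hc : Function.Injective c := by
    refine Function.LeftInverse.injective
      (g := (hA.eigenvectorUnitary : Matrix n n ℝ).mulVec) fun x => ?_
    simp [c, Matrix.mulVec_mulVec]
  have hn : Fintype.card n = Module.finrank ℝ (n → ℝ) := by simp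
  have heq : ∀ x, ∑ i, hA.eigenvalues i * c x i ^ 2 = ∑ j, e j * b x j ^ 2 := fun x =>
    (hA.dotProduct_mulVec_eq_sum_eigenvalues x).symm.trans (h x)
  have hneg : ∀ x, ∑ i, -hA.eigenvalues i * c x i ^ 2 = ∑ j, -e j * b x j ^ 2 := fun x => by
    simp only [neg_mul, sum_neg_distrib, heq x]
  refine ⟨le_antisymm (card_pos_le_of_sum_sq_eq c hc hn b _ _ heq)
    (card_pos_le_of_sum_sq_eq b hb hn c _ _ fun x => (heq x).symm), ?_⟩
  simpa only [Left.neg_pos_iff] using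
    le_antisymm (card_pos_le_of_sum_sq_eq c hc hn b _ _ hneg)
      (card_pos_le_of_sum_sq_eq b hb hn c _ _ fun x => (hneg x).symm)

/-- Coordinates diagonalizing the quadratic form of `G4`, adapted to its splitting under the
symmetry of the diagram. -/
noncomputable def G4Coords : Matrix (Fin 7) (Fin 7) ℝ :=
  !![-(√2 + √15 / 3) / 2, -(√2 + √15 / 3) / 2, 1 / 2, 1 / 2, -1 / 4, 0, -1 / 4;
     2 * (√2 + √15 / 3), 2 * (√2 + √15 / 3), 0, 0, 1, 0, 1;
     0, 0, 0, 0, 1 / 2, -1, 1 / 2;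
     1, -1, -√15 / 6, √15 / 6, 0, 0, 0;
     0, 0, -1 / 6, 1 / 6, 1 / 2, 0, -1 / 2;
     1 / 2, 1 / 2, 0, 0, 0, 0, 0;
     0, 0, 1 / 2, -1 / 2, 0, 0, 0]

theorem G4Coords_mulVec_injective : Function.Injective G4Coords.mulVecLin := by
  rw [← LinearMap.ker_eq_bot, LinearMap.ker_eq_bot']
  intro x hx
  have h := fun i => congrFun hx i
  simp only [G4Coords, Matrix.mulVecLin_apply, Matrix.mulVec, dotProduct,
    Fin.forall_fin_succ, Fin.sum_univ_seven] at h
  simp at h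
  obtain ⟨h0, h1, h2, h3, h4, h5, h6⟩ := h
  have hs : x 1 = -x 0 := by linarith
  have hd : x 3 = x 2 := by linarith
  rw [hs] at h0 h1 h3
  rw [hd] at h0 h3 h4
  ext i
  fin_cases i <;> simp <;> linarith

theorem G4_dotProduct_mulVec (x : Fin 7 → ℝ) :
    x ⬝ᵥ G4.mulVec x = ∑ j, ![2, -1 / 8, 1, 1, 3, 0, 0] j * G4Coords.mulVecLin x j ^ 2 := by
  have h15 : √15 ^ 2 = 15 := Real.sq_sqrt (by norm_num)
  simp [G4, G4Coords, Matrix.mulVec, dotProduct, Fin.sum_univ_seven]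
  linear_combination (-(x 2 - x 3) ^ 2 / 36) * h15

theorem stmt_4 (hG : G4.IsHermitian) :
    (Finset.univ.filter fun j => 0 < hG.eigenvalues j).card = 4 ∧
    (Finset.univ.filter fun j => hG.eigenvalues j < 0).card = 1 ∧
    (Finset.univ.filter fun j => hG.eigenvalues j = 0).card = 2 ∧
    G4.rank = 5 := by
  obtain ⟨hpos, hneg⟩ := hG.card_eigenvalues_of_sum_sq _ G4Coords_mulVec_injective
    ![2, -1 / 8, 1, 1, 3, 0, 0] G4_dotProduct_mulVec
  replace hpos := hpos.trans (c := 4) (by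
    simp only [Finset.card_filter, Fin.sum_univ_seven, Matrix.cons_val]; norm_num)
  replace hneg := hneg.trans (c := 1) (by
    simp only [Finset.card_filter, Fin.sum_univ_seven, Matrix.cons_val]; norm_num)
  have hne : (Finset.univ.filter fun j => hG.eigenvalues j ≠ 0).card = 5 := by
    rw [show (5 : ℕ) = 1 + 4 from rfl, ← hneg, ← hpos, ← Finset.card_union_of_disjoint,
      ← Finset.filter_or]
    · simp only [ne_iff_lt_or_gt]
    · exact Finset.disjoint_filter.2 fun j _ h => h.not_gt
  have hsum := Finset.card_filter_add_card_filter_not (s := (Finset.univ : Finset (Fin 7)))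
    (fun j => hG.eigenvalues j = 0)
  rw [Finset.card_univ, Fintype.card_fin] at hsum
  have hzero : (Finset.univ.filter fun j => hG.eigenvalues j = 0).card + 5 = 7 := hne ▸ hsum
  refine ⟨hpos, hneg, by omega, ?_⟩
  rw [hG.rank_eq_card_non_zero_eigs, Fintype.card_subtype, hne]
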